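/- Fix s ∈ ℝ₊ and a countable set χ of cadlag F^o-adapted real processes which are uniformly bounded on each interval [0,T]. Then the set A_s := ∪_{η∈Ω} MP^{s,η}(χ) of probability measures on (Ω,F) solving the martingale problem with respect to χ for some starting path is a measurable subset of the space of probability measures on (Ω,F), equipped with the σ-field generated by the evaluation maps ℙ ↦ ℙ(F), F ∈ F (which is the Borel σ-field of the topology of weak convergence when Ω carries the Skorokhod topology). -/

import Mathlib

open MeasureTheory Filter Topology Set
open scoped NNReal ENNReal

noncomputable section

/-- A function indexed by `ℝ≥0` is *cadlag* if it is right-continuous and has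
left limits at every positive time. -/
def IsCadlag {X : Type*} [TopologicalSpace X] (f : ℝ≥0 → X) : Prop :=
  (∀ t : ℝ≥0, Tendsto f (𝓝[Set.Ici t] t) (𝓝 (f t))) ∧
    ∀ t : ℝ≥0, 0 < t → ∃ l : X, Tendsto f (𝓝[Set.Iio t] t) (𝓝 l)

variable (E : Type*) [MetricSpace E] [MeasurableSpace E]

/-- The canonical path space `Ω = D(ℝ₊, E)` of cadlag paths with values in `E`. -/
def PathOmega := {f : ℝ≥0 → E // IsCadlag f}

/-- The canonical σ-field `𝓕 = σ(X_r ; r ≥ 0)` on the path space. -/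
instance instPathOmegaMS : MeasurableSpace (PathOmega E) :=
  ⨆ r : ℝ≥0, MeasurableSpace.comap (fun ω : PathOmega E => ω.1 r) inferInstance

/-- The initial filtration `𝓕^o_t = σ(X_r ; r ≤ t)`. -/
def Fot (t : ℝ≥0) : MeasurableSpace (PathOmega E) :=
  ⨆ r ∈ Set.Iic t, MeasurableSpace.comap (fun ω : PathOmega E => ω.1 r) inferInstance

/-- The canonical (right-continuous) filtration `𝓕_t = ⋂_{s > t} 𝓕^o_s`. -/
def Ft (t : ℝ≥0) : MeasurableSpace (PathOmega E) :=
  ⨅ u ∈ Set.Ioi t, Fot E u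

variable {E}

/-- A *path-dependent canonical class*. -/
structure IsPathCanonicalClass (P : ℝ≥0 → PathOmega E → Measure (PathOmega E)) : Prop where
  isProb : ∀ s η, IsProbabilityMeasure (P s η)
  starts : ∀ (s : ℝ≥0) (η : PathOmega E), P s η {ω | ∀ r ≤ s, ω.1 r = η.1 r} = 1
  fos_meas : ∀ (s : ℝ≥0) (F : Set (PathOmega E)), MeasurableSet F →
    Measurable[Fot E s] fun η => P s η F
  cond : ∀ (s : ℝ≥0) (η : PathOmega E) (t : ℝ≥0), s ≤ t →
    ∀ F : Set (PathOmega E), MeasurableSet F →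
      ∀ G : Set (PathOmega E), MeasurableSet[Fot E t] G →
        ∫⁻ ω in G, P t ω F ∂(P s η) = P s η (F ∩ G)

variable (E)


/-- A process `M` is a martingale on `[s, ∞)` with respect to the measure `μ`
and the filtration `𝔽`: it is integrable at each time `t ≥ s` and has the
martingale property for `s ≤ t ≤ u`, expressed through set integrals over
`𝔽 t`-measurable events. -/
def IsMartingaleOn (μ : Measure (PathOmega E))
    (𝔽 : ℝ≥0 → MeasurableSpace (PathOmega E))
    (M : ℝ≥0 → PathOmega E → ℝ) (s : ℝ≥0) : Prop :=
  (∀ t : ℝ≥0, s ≤ t → Integrable (M t) μ) ∧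
    ∀ t u : ℝ≥0, s ≤ t → t ≤ u → ∀ G : Set (PathOmega E), MeasurableSet[𝔽 t] G →
      ∫ ω in G, M u ω ∂μ = ∫ ω in G, M t ω ∂μ


/-- A probability measure `μ` solves the martingale problem with respect to a
set of processes `χ` starting in `(s,η)`: `μ(ω^s = η^s) = 1` and every element
of `χ` is a `(μ, 𝓕^o)`-martingale on `[s, ∞)`. -/
def SolvesMP (χ : Set (ℝ≥0 → PathOmega E → ℝ)) (s : ℝ≥0) (η : PathOmega E)
    (μ : Measure (PathOmega E)) : Prop :=
  μ {ω | ∀ r ≤ s, ω.1 r = η.1 r} = 1 ∧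
    ∀ M ∈ χ, IsMartingaleOn E μ (Fot E) M s

/-- A countable set of times which determines a cadlag path on `[0, s]`. -/
def determiningTimes (s : ℝ≥0) : Set ℝ≥0 :=
  insert s (range (TopologicalSpace.denseSeq ℝ≥0) ∩ Iio s)

lemma countable_determiningTimes (s : ℝ≥0) : (determiningTimes s).Countable :=
  ((countable_range _).mono inter_subset_left).insert s

lemma le_of_mem_determiningTimes {s r : ℝ≥0} (hr : r ∈ determiningTimes s) : r ≤ s := by
  rcases hr with rfl | hr
  · exact le_rfl
  · exact le_of_lt hr.2

lemma IsCadlag.tendsto_seq_of_lt {X : Type*} [TopologicalSpace X] {f : ℝ≥0 → X}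
    (hf : IsCadlag f) {t : ℝ≥0} {v : ℕ → ℝ≥0} (hv : ∀ n, t < v n)
    (hlim : Tendsto v atTop (𝓝 t)) : Tendsto (fun n => f (v n)) atTop (𝓝 (f t)) :=
  (hf.1 t).comp <| tendsto_nhdsWithin_iff.2 ⟨hlim, .of_forall fun n => (hv n).le⟩

lemma exists_seq_determiningTimes {s r : ℝ≥0} (hr : r < s) :
    ∃ v : ℕ → ℝ≥0, (∀ n, r < v n) ∧ (∀ n, v n ∈ determiningTimes s) ∧
      Tendsto v atTop (𝓝 r) := by
  obtain ⟨v, -, hv, hlim⟩ :=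
    Dense.exists_seq_strictAnti_tendsto_of_lt (TopologicalSpace.denseRange_denseSeq ℝ≥0) hr
  exact ⟨v, fun n => (hv n).1.1, fun n => .inr ⟨(hv n).2, (hv n).1.2⟩, hlim⟩

lemma IsCadlag.eq_of_eqOn_determiningTimes {X : Type*} [TopologicalSpace X] [T2Space X]
    {f g : ℝ≥0 → X} (hf : IsCadlag f) (hg : IsCadlag g) {s : ℝ≥0}
    (h : EqOn f g (determiningTimes s)) : ∀ r ≤ s, f r = g r := by
  intro r hr
  rcases hr.eq_or_lt with rfl | hr
  · exact h (mem_insert _ _)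
  · obtain ⟨v, hv, hmem, hlim⟩ := exists_seq_determiningTimes hr
    refine tendsto_nhds_unique (hf.tendsto_seq_of_lt hv hlim) ?_
    simpa only [h (hmem _)] using hg.tendsto_seq_of_lt hv hlim

lemma measurable_eval (r : ℝ≥0) : Measurable fun ω : PathOmega E => ω.1 r :=
  measurable_iff_comap_le.2 <|
    le_iSup (fun r : ℝ≥0 => MeasurableSpace.comap (fun ω : PathOmega E => ω.1 r) _) r

lemma Fot_le (t : ℝ≥0) : Fot E t ≤ instPathOmegaMS E :=
  iSup₂_le fun r _ => measurable_iff_comap_le.1 (measurable_eval E r)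

lemma Fot_mono {t u : ℝ≥0} (h : t ≤ u) : Fot E t ≤ Fot E u :=
  biSup_mono fun _ hr => le_trans hr h

lemma Fot_eq_iSup_determiningTimes [BorelSpace E] (s : ℝ≥0) :
    Fot E s = ⨆ r : determiningTimes s,
      MeasurableSpace.comap (fun ω : PathOmega E => ω.1 r) inferInstance := by
  apply le_antisymm
  · refine iSup₂_le fun r hr => ?_
    rw [← measurable_iff_comap_le]
    have key : ∀ q ∈ determiningTimes s,
        Measurable[⨆ r : determiningTimes s, MeasurableSpace.comap
          (fun ω : PathOmega E => ω.1 r) inferInstance] fun ω : PathOmega E => ω.1 q :=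
      fun q hq => measurable_iff_comap_le.2 <|
        le_iSup (fun r : determiningTimes s =>
          MeasurableSpace.comap (fun ω : PathOmega E => ω.1 r) _) ⟨q, hq⟩
    rcases (show r ≤ s from hr).eq_or_lt with rfl | hlt
    · exact key _ (mem_insert _ _)
    · obtain ⟨v, hv, hmem, hlim⟩ := exists_seq_determiningTimes hlt
      exact @measurable_of_tendsto_metrizable _ _ (_) _ _ _ _ _ _
        (fun n => key (v n) (hmem n))
        (tendsto_pi_nhds.2 fun ω => ω.2.tendsto_seq_of_lt hv hlim)
  · exact iSup_le fun r => le_iSup₂ (f := fun (q : ℝ≥0) (_ : q ∈ Iic s) =>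
      MeasurableSpace.comap (fun ω : PathOmega E => ω.1 q) inferInstance)
      r.1 (le_of_mem_determiningTimes r.2)

open TopologicalSpace in
lemma exists_countable_algebra_generating_Fot [SeparableSpace E] [BorelSpace E] (s : ℝ≥0) :
    ∃ 𝒜 : Set (Set (PathOmega E)), 𝒜.Countable ∧ IsSetAlgebra 𝒜 ∧
      Fot E s = MeasurableSpace.generateFrom 𝒜 := by
  have : SecondCountableTopology E := UniformSpace.secondCountable_of_separable E
  have : Countable (determiningTimes s) := (countable_determiningTimes s).to_subtype
  let ℬ : Set (Set (PathOmega E)) :=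
    ⋃ r : determiningTimes s, preimage (fun ω : PathOmega E => ω.1 r) '' countableBasis E
  refine ⟨generateSetAlgebra ℬ, countable_generateSetAlgebra <|
    countable_iUnion fun r => (countable_countableBasis E).image _,
    isSetAlgebra_generateSetAlgebra, ?_⟩
  rw [generateFrom_generateSetAlgebra_eq, Fot_eq_iSup_determiningTimes,
    ← MeasurableSpace.iSup_generateFrom]
  simp only [BorelSpace.measurable_eq (α := E),
    (isBasis_countableBasis E).borel_eq_generateFrom, MeasurableSpace.comap_generateFrom]

lemma MeasureTheory.setIntegral_eq_of_isSetAlgebra {Ω : Type*} {m m₀ : MeasurableSpace Ω}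
    {μ : @Measure Ω m₀} (hm : m ≤ m₀) {𝒜 : Set (Set Ω)} (h𝒜 : IsSetAlgebra 𝒜)
    (hgen : m = MeasurableSpace.generateFrom 𝒜) {f g : Ω → ℝ} (hf : Integrable f μ)
    (hg : Integrable g μ) (h : ∀ A ∈ 𝒜, ∫ ω in A, f ω ∂μ = ∫ ω in A, g ω ∂μ)
    {A : Set Ω} (hA : MeasurableSet[m] A) : ∫ ω in A, f ω ∂μ = ∫ ω in A, g ω ∂μ := by
  have huniv : ∫ ω, f ω ∂μ = ∫ ω, g ω ∂μ := by simpa using h univ h𝒜.univ_mem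
  induction A, hA using MeasurableSpace.induction_on_inter hgen
    (fun _ hs _ ht _ => h𝒜.inter_mem hs ht) with
  | empty => simp
  | basic A hA => exact h A hA
  | compl A hA ih =>
    rw [setIntegral_compl (hm _ hA) hf, setIntegral_compl (hm _ hA) hg, ih, huniv]
  | iUnion A hdisj hA ih =>
    rw [integral_iUnion (fun i => hm _ (hA i)) hdisj hf.integrableOn,
      integral_iUnion (fun i => hm _ (hA i)) hdisj hg.integrableOn]
    simp only [ih]

/-- If all the events `{ω r ∈ U}`, for `r` in the determining times and `U` in a countable basis,
are trivial under `μ`, then `μ` fixes the path up to time `s`, and conversely. -/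
lemma exists_initial_path_iff [TopologicalSpace.SeparableSpace E] [BorelSpace E]
    (μ : Measure (PathOmega E)) [IsProbabilityMeasure μ] (s : ℝ≥0) :
    (∃ η : PathOmega E, μ {ω | ∀ r ≤ s, ω.1 r = η.1 r} = 1) ↔
      ∀ r ∈ determiningTimes s, ∀ U ∈ TopologicalSpace.countableBasis E,
        μ {ω | ω.1 r ∈ U} = 0 ∨ μ {ω | ω.1 r ∉ U} = 0 := by
  have : SecondCountableTopology E := UniformSpace.secondCountable_of_separable E
  have hbasis := TopologicalSpace.isBasis_countableBasis E
  constructor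
  · rintro ⟨η, hη⟩ r hr U hU
    have hmeas : MeasurableSet {ω : PathOmega E | ω.1 r = η.1 r} :=
      measurable_eval E r (measurableSet_singleton _)
    have hone : μ {ω | ω.1 r = η.1 r} = 1 :=
      le_antisymm prob_le_one (hη ▸ measure_mono fun ω hω => hω r (le_of_mem_determiningTimes hr))
    have hzero := (prob_compl_eq_zero_iff hmeas).2 hone
    by_cases hmem : η.1 r ∈ U
    · exact .inr <| measure_mono_null (fun ω hω (heq : ω.1 r = η.1 r) => hω (heq ▸ hmem)) hzero
    · exact .inl <| measure_mono_null (fun ω (hω : ω.1 r ∈ U) (heq : ω.1 r = η.1 r) => hmem (heq ▸ hω)) hzero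
  · intro h
    have hae : ∀ᵐ ω ∂μ, ∀ r ∈ determiningTimes s, ∀ U ∈ TopologicalSpace.countableBasis E,
        (ω.1 r ∈ U ↔ μ {ω | ω.1 r ∉ U} = 0) := by
      rw [ae_ball_iff (countable_determiningTimes s)]
      intro r hr
      rw [ae_ball_iff (TopologicalSpace.countable_countableBasis E)]
      intro U hU
      by_cases h0 : μ {ω | ω.1 r ∉ U} = 0
      · simpa only [h0, iff_true] using ae_iff.2 h0
      · have := (h r hr U hU).resolve_right h0
        simpa only [h0, iff_false] using ae_iff.2 (by simpa only [not_not] using this)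
    obtain ⟨η, hη⟩ := hae.exists
    refine ⟨η, ?_⟩
    suffices ∀ᵐ ω ∂μ, ∀ r ≤ s, ω.1 r = η.1 r from
      le_antisymm prob_le_one (by
        rw [← measure_univ (μ := μ)]
        exact measure_mono_ae (by filter_upwards [this] with ω hω _ using hω))
    filter_upwards [hae] with ω hω
    refine ω.2.eq_of_eqOn_determiningTimes η.2 fun r hr => ?_
    by_contra hne
    obtain ⟨U, hU, hmem, hsub⟩ := hbasis.exists_subset_of_mem_open
      (show ω.1 r ∈ ({η.1 r}ᶜ : Set E) from hne) isOpen_compl_singleton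
    exact hsub (((hη r hr U hU).trans (hω r hr U hU).symm).2 hmem) rfl

variable {E} in
lemma integrable_of_adapted_of_bounded {M : ℝ≥0 → PathOmega E → ℝ}
    (hadapted : ∀ t, Measurable[Fot E t] (M t))
    (hbdd : ∀ T : ℝ≥0, ∃ C : ℝ, ∀ t ≤ T, ∀ ω : PathOmega E, |M t ω| ≤ C)
    (μ : Measure (PathOmega E)) [IsFiniteMeasure μ] (t : ℝ≥0) : Integrable (M t) μ := by
  obtain ⟨C, hC⟩ := hbdd t
  exact .of_bound ((hadapted t).mono (Fot_le E t) le_rfl).aestronglyMeasurable C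
    (.of_forall fun ω => hC t le_rfl ω)

/-- For a cadlag, adapted, locally bounded process, the martingale property need only be tested at
countably many times and on generating algebras. -/
lemma isMartingaleOn_iff_countable [BorelSpace E] {M : ℝ≥0 → PathOmega E → ℝ}
    (hcadlag : ∀ ω : PathOmega E, IsCadlag fun t => M t ω)
    (hadapted : ∀ t, Measurable[Fot E t] (M t))
    (hbdd : ∀ T : ℝ≥0, ∃ C : ℝ, ∀ t ≤ T, ∀ ω : PathOmega E, |M t ω| ≤ C)
    {𝒜 : ℝ≥0 → Set (Set (PathOmega E))} (h𝒜 : ∀ t, IsSetAlgebra (𝒜 t))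
    (hgen : ∀ t, Fot E t = MeasurableSpace.generateFrom (𝒜 t))
    (μ : Measure (PathOmega E)) [IsFiniteMeasure μ] (s : ℝ≥0) :
    IsMartingaleOn E μ (Fot E) M s ↔
      ∀ t ∈ range (TopologicalSpace.denseSeq ℝ≥0), ∀ u ∈ range (TopologicalSpace.denseSeq ℝ≥0),
        s ≤ t → t ≤ u → ∀ A ∈ 𝒜 t, ∫ ω in A, M u ω ∂μ = ∫ ω in A, M t ω ∂μ := by
  have hint := integrable_of_adapted_of_bounded hadapted hbdd μ
  constructor
  · exact fun h t _ u _ hst htu A hA =>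
      h.2 t u hst htu A (hgen t ▸ MeasurableSpace.measurableSet_generateFrom hA)
  · intro h
    refine ⟨fun t _ => hint t, fun t u hst htu A hA => ?_⟩
    rcases htu.eq_or_lt with rfl | htu
    · rfl
    have hlim : ∀ (r R : ℝ≥0) (v : ℕ → ℝ≥0), (∀ n, r < v n) → (∀ n, v n < R) →
        Tendsto v atTop (𝓝 r) →
        Tendsto (fun n => ∫ ω in A, M (v n) ω ∂μ) atTop (𝓝 (∫ ω in A, M r ω ∂μ)) := by
      intro r R v hr hR hv
      obtain ⟨C, hC⟩ := hbdd R
      exact tendsto_integral_of_dominated_convergence (fun _ => C)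
        (fun n => (hint (v n)).integrableOn.aestronglyMeasurable) (integrable_const C)
        (fun n => .of_forall fun ω => hC _ (hR n).le ω)
        (.of_forall fun ω => (hcadlag ω).tendsto_seq_of_lt hr hv)
    have hdense : Dense _ := TopologicalSpace.denseRange_denseSeq ℝ≥0
    obtain ⟨v, -, hv, hvlim⟩ := hdense.exists_seq_strictAnti_tendsto_of_lt htu
    obtain ⟨w, -, hw, hwlim⟩ := hdense.exists_seq_strictAnti_tendsto_of_lt (lt_add_one u)
    refine tendsto_nhds_unique (hlim u _ w (fun n => (hw n).1.1) (fun n => (hw n).1.2) hwlim) ?_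
    refine (hlim t _ v (fun n => (hv n).1.1) (fun n => (hv n).1.2) hvlim).congr fun n => ?_
    refine (setIntegral_eq_of_isSetAlgebra (Fot_le E (v n)) (h𝒜 _) (hgen _) (hint _) (hint _)
      (h _ (hv n).2 _ (hw n).2 (hst.trans (hv n).1.1.le) ((hv n).1.2.trans (hw n).1.1).le)
      (Fot_mono E (hv n).1.1.le _ hA)).symm

/-- The positive-part/negative-part expression of a Bochner integral depends measurably on the
measure. -/
lemma MeasureTheory.Measure.measurable_toReal_lintegral_sub {Ω : Type*} [MeasurableSpace Ω]
    {f : Ω → ℝ} (hf : Measurable f) {A : Set Ω} (hA : MeasurableSet A) :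
    Measurable fun μ : Measure Ω =>
      (∫⁻ ω in A, ENNReal.ofReal (f ω) ∂μ).toReal -
        (∫⁻ ω in A, ENNReal.ofReal (-f ω) ∂μ).toReal := by
  simp only [← lintegral_indicator hA]
  exact (Measure.measurable_lintegral (hf.ennreal_ofReal.indicator hA)).ennreal_toReal.sub
    (Measure.measurable_lintegral (hf.neg.ennreal_ofReal.indicator hA)).ennreal_toReal

lemma MeasureTheory.Measure.measurable_setIntegral_isProbabilityMeasure {Ω : Type*}
    [MeasurableSpace Ω] {f : Ω → ℝ} (hf : Measurable f) {C : ℝ} (hC : ∀ ω, |f ω| ≤ C)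
    {A : Set Ω} (hA : MeasurableSet A) :
    Measurable fun μ : {μ : Measure Ω // IsProbabilityMeasure μ} => ∫ ω in A, f ω ∂μ.1 := by
  convert (Measure.measurable_toReal_lintegral_sub hf hA).comp measurable_subtype_coe using 1
  funext ⟨μ, hμ⟩
  exact integral_eq_lintegral_pos_part_sub_lintegral_neg_part
    (Integrable.of_bound hf.aestronglyMeasurable C (.of_forall hC))

/-- Proposition 4.8: the set `A_s` of probability measures
solving the martingale problem with respect to `χ` starting at time `s` for
some starting path is a measurable subset of the space of (probability)
measures on `(Ω, 𝓕)`, equipped with the σ-field generated by the evaluation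
maps `ℙ ↦ ℙ(F)`. -/
theorem measurableSet_MP_solutions [TopologicalSpace.SeparableSpace E]
    [CompleteSpace E] [BorelSpace E]
    (χ : Set (ℝ≥0 → PathOmega E → ℝ)) (hχcount : χ.Countable)
    (hχcadlag : ∀ M ∈ χ, ∀ ω : PathOmega E, IsCadlag fun t => M t ω)
    (hχadapted : ∀ M ∈ χ, ∀ t : ℝ≥0, Measurable[Fot E t] (M t))
    (hχbdd : ∀ T : ℝ≥0, ∃ C : ℝ, ∀ M ∈ χ, ∀ t ≤ T, ∀ ω : PathOmega E, |M t ω| ≤ C)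
    (s : ℝ≥0) :
    MeasurableSet {μ : Measure (PathOmega E) |
      IsProbabilityMeasure μ ∧ ∃ η : PathOmega E, SolvesMP E χ s η μ} := by
  choose 𝒜 h𝒜count h𝒜alg h𝒜gen using exists_countable_algebra_generating_Fot E
  have hbdd : ∀ M ∈ χ, ∀ T : ℝ≥0, ∃ C : ℝ, ∀ t ≤ T, ∀ ω : PathOmega E, |M t ω| ≤ C :=
    fun M hM T => (hχbdd T).imp fun C hC => hC M hM
  have heq : {μ : Measure (PathOmega E) | IsProbabilityMeasure μ ∧ ∃ η, SolvesMP E χ s η μ} =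
      Subtype.val '' {μ : {μ : Measure (PathOmega E) // IsProbabilityMeasure μ} |
        (∀ r ∈ determiningTimes s, ∀ U ∈ TopologicalSpace.countableBasis E,
          μ.1 {ω | ω.1 r ∈ U} = 0 ∨ μ.1 {ω | ω.1 r ∉ U} = 0) ∧
        ∀ M ∈ χ, ∀ t ∈ range (TopologicalSpace.denseSeq ℝ≥0),
          ∀ u ∈ range (TopologicalSpace.denseSeq ℝ≥0), s ≤ t → t ≤ u →
            ∀ A ∈ 𝒜 t, ∫ ω in A, M u ω ∂μ.1 = ∫ ω in A, M t ω ∂μ.1} := by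
    ext μ
    simp only [mem_ofPred_eq, mem_image, Subtype.exists]
    have hiff (hμ : IsProbabilityMeasure μ) :=
      and_congr (exists_initial_path_iff E μ s) <| forall₂_congr fun M hM =>
      isMartingaleOn_iff_countable E (hχcadlag M hM) (hχadapted M hM) (hbdd M hM)
        h𝒜alg h𝒜gen μ s
    constructor
    · rintro ⟨hμ, η, hη, hmart⟩
      exact ⟨μ, hμ, (hiff hμ).1 ⟨⟨η, hη⟩, hmart⟩, rfl⟩
    · rintro ⟨μ, hμ, h, rfl⟩
      obtain ⟨⟨η, hη⟩, hmart⟩ := (hiff hμ).2 h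
      exact ⟨hμ, η, hη, hmart⟩
  have hQ := countable_range (TopologicalSpace.denseSeq ℝ≥0)
  have : SecondCountableTopology E := UniformSpace.secondCountable_of_separable E
  rw [heq]
  simp only [ofPred_and, ofPred_forall]
  refine MeasurableSet.subtype_image
    ProbabilityMeasure.measurableSet_isProbabilityMeasure (.inter ?_ ?_)
  · refine .biInter (countable_determiningTimes s) fun r _ =>
      .biInter (TopologicalSpace.countable_countableBasis E) fun U hU => ?_
    have hU' : MeasurableSet {ω : PathOmega E | ω.1 r ∈ U} :=
      measurable_eval E r (TopologicalSpace.isOpen_of_mem_countableBasis hU).measurableSet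
    exact .union
      ((Measure.measurable_coe hU').comp measurable_subtype_coe (measurableSet_singleton 0))
      ((Measure.measurable_coe hU'.compl).comp measurable_subtype_coe (measurableSet_singleton 0))
  · refine .biInter hχcount fun M hM => .biInter hQ fun t _ => .biInter hQ fun u _ =>
      .iInter fun _ => .iInter fun _ => .biInter (h𝒜count t) fun A hA => ?_
    have hA' : MeasurableSet A :=
      Fot_le E t _ (h𝒜gen t ▸ MeasurableSpace.measurableSet_generateFrom hA)
    have hmeas : ∀ v, Measurable fun μ : {μ : Measure (PathOmega E) // IsProbabilityMeasure μ} =>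
        ∫ ω in A, M v ω ∂μ.1 := fun v =>
      have ⟨C, hC⟩ := hbdd M hM v
      Measure.measurable_setIntegral_isProbabilityMeasure
        ((hχadapted M hM v).mono (Fot_le E v) le_rfl) (hC v le_rfl) hA'
    exact measurableSet_eq_fun (hmeas u) (hmeas t)
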